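/- The standard lattice 𝕃₃ = k[[t]]⟨e₁, e₂, t·u₁, t·u₂, u₃, v₁, v₂, t·v₃⟩ in the split para-octonion algebra over k((t)) is closed under ⋆, satisfies 𝕃₃ ⊊ 𝕃₃^∨ ⊊ t⁻¹𝕃₃, and the lattice M := t·(𝕃₃^∨ ⋆ 𝕃₃^∨) + 𝕃₃ equals k[[t]]⟨e₁, e₂, u₁, u₂, t⁻¹u₃, v₁, v₂, t·v₃⟩ and is self-dual. -/

import Mathlib

noncomputable section

variable (k : Type*) [Field k]

/-- The split para-octonion algebra over `k((t))`, coordinatized by the standard basis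
`e₁, e₂, u₁, u₂, u₃, v₁, v₂, v₃` (indices `0,…,7`). -/
abbrev C8 := Fin 8 → LaurentSeries k

/-- The standard basis vectors. -/
def E (n : Fin 8) : C8 k := Pi.single n 1

/-- Structure constants of the para-octonion multiplication `⋆` (Table 1):
`e₁⋆e₁=e₂`, `e₂⋆e₂=e₁`, `e₁⋆e₂=e₂⋆e₁=0`, `e₂⋆uᵢ=uᵢ⋆e₁=−uᵢ`, `e₁⋆vᵢ=vᵢ⋆e₂=−vᵢ`,
`uᵢ⋆vⱼ=−δᵢⱼe₁`, `vᵢ⋆uⱼ=−δᵢⱼe₂`, `uᵢ⋆uⱼ=εᵢⱼₗvₗ`, `vᵢ⋆vⱼ=εᵢⱼₗuₗ`. -/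
def bmul (i j : Fin 8) : C8 k :=
  match i.1, j.1 with
  | 0, 0 => E k 1
  | 1, 1 => E k 0
  | 1, 2 => -E k 2 | 1, 3 => -E k 3 | 1, 4 => -E k 4
  | 2, 0 => -E k 2 | 3, 0 => -E k 3 | 4, 0 => -E k 4
  | 0, 5 => -E k 5 | 0, 6 => -E k 6 | 0, 7 => -E k 7
  | 5, 1 => -E k 5 | 6, 1 => -E k 6 | 7, 1 => -E k 7
  | 2, 5 => -E k 0 | 3, 6 => -E k 0 | 4, 7 => -E k 0
  | 5, 2 => -E k 1 | 6, 3 => -E k 1 | 7, 4 => -E k 1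
  | 2, 3 => E k 7 | 3, 2 => -E k 7
  | 3, 4 => E k 5 | 4, 3 => -E k 5
  | 4, 2 => E k 6 | 2, 4 => -E k 6
  | 5, 6 => E k 4 | 6, 5 => -E k 4
  | 6, 7 => E k 2 | 7, 6 => -E k 2
  | 7, 5 => E k 3 | 5, 7 => -E k 3
  | _, _ => 0

/-- The para-octonion multiplication `⋆`, extended bilinearly from the table. -/
def star8 (x y : C8 k) : C8 k := ∑ i, ∑ j, (x i * y j) • bmul k i j

/-- The bilinear form: `⟨e₁,e₂⟩ = 1`, `⟨uᵢ,vⱼ⟩ = δᵢⱼ`, all other pairings `0`. -/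
def bf8 (x y : C8 k) : LaurentSeries k :=
  x 0 * y 1 + x 1 * y 0 + x 2 * y 5 + x 5 * y 2 + x 3 * y 6 + x 6 * y 3
    + x 4 * y 7 + x 7 * y 4

/-- The uniformizer `t` of `k[[t]]`, viewed in `k((t))`. -/
def tK : LaurentSeries k := algebraMap (PowerSeries k) (LaurentSeries k) PowerSeries.X

/-- The dual lattice `L^∨ = {x : ⟨x, L⟩ ⊆ k[[t]]}`. -/
def dualL (L : Submodule (PowerSeries k) (C8 k)) : Submodule (PowerSeries k) (C8 k) :=
  Submodule.span (PowerSeries k)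
    {x | ∀ y ∈ L, bf8 k x y ∈ Set.range (algebraMap (PowerSeries k) (LaurentSeries k))}

/-- The lattice `t⁻¹L`. -/
def tinvL (L : Submodule (PowerSeries k) (C8 k)) : Submodule (PowerSeries k) (C8 k) :=
  Submodule.span (PowerSeries k) ((fun x => (tK k)⁻¹ • x) '' (L : Set (C8 k)))

/-- The standard lattice `𝕃₃ = k[[t]]⟨e₁, e₂, t·u₁, t·u₂, u₃, v₁, v₂, t·v₃⟩`. -/
def L3 : Submodule (PowerSeries k) (C8 k) :=
  Submodule.span (PowerSeries k)
    {E k 0, E k 1, tK k • E k 2, tK k • E k 3, E k 4, E k 5, E k 6, tK k • E k 7}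

/-- The lattice `M = t·(𝕃₃^∨ ⋆ 𝕃₃^∨) + 𝕃₃`. -/
def M3 : Submodule (PowerSeries k) (C8 k) :=
  Submodule.span (PowerSeries k)
      ((fun x => tK k • x) ''
        Set.image2 (star8 k) (dualL k (L3 k) : Set (C8 k)) (dualL k (L3 k) : Set (C8 k)))
    ⊔ L3 k

section

/-- The fractional ideal `tⁿ k[[t]]` of `k((t))`. -/
def tPowSpan (n : ℤ) : Submodule (PowerSeries k) (LaurentSeries k) :=
  Submodule.span (PowerSeries k) {tK k ^ n}

/-- The lattice of vectors whose `i`-th coordinate lies in `t ^ (a i) k[[t]]`. -/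
def boxL (a : Fin 8 → ℤ) : Submodule (PowerSeries k) (C8 k) :=
  Submodule.pi Set.univ fun i => tPowSpan k (a i)

/-- The involution on indices matching each basis vector with its dual for `bf8`. -/
def dualIdx : Fin 8 → Fin 8 := ![1, 0, 5, 6, 7, 2, 3, 4]

/-- The index `n` with `bmul k i j = ± E k n`, or `none` when the product vanishes. -/
def prodIdx : Fin 8 → Fin 8 → Option (Fin 8) :=
  ![![some 1, none, none, none, none, some 5, some 6, some 7],
    ![none, some 0, some 2, some 3, some 4, none, none, none],
    ![some 2, none, none, some 7, some 6, some 0, none, none],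
    ![some 3, none, some 7, none, some 5, none, some 0, none],
    ![some 4, none, some 6, some 5, none, none, none, some 0],
    ![none, some 5, some 1, none, none, none, some 4, some 3],
    ![none, some 6, none, some 1, none, some 4, none, some 2],
    ![none, some 7, none, none, some 1, some 3, some 2, none]]

variable {k}

lemma tK_ne_zero : tK k ≠ 0 := by
  simp only [tK, ne_eq]
  rw [FaithfulSMul.algebraMap_eq_zero_iff]
  exact PowerSeries.X_ne_zero

lemma zpow_mem_tPowSpan (n : ℤ) : tK k ^ n ∈ tPowSpan k n :=
  Submodule.mem_span_singleton_self _

lemma mul_mem_tPowSpan {m n : ℤ} {x y : LaurentSeries k} (hx : x ∈ tPowSpan k m)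
    (hy : y ∈ tPowSpan k n) : x * y ∈ tPowSpan k (m + n) := by
  obtain ⟨c, rfl⟩ := Submodule.mem_span_singleton.1 hx
  obtain ⟨d, rfl⟩ := Submodule.mem_span_singleton.1 hy
  refine Submodule.mem_span_singleton.2 ⟨c * d, ?_⟩
  rw [zpow_add₀ tK_ne_zero]
  simp only [Algebra.smul_def, map_mul]
  ring

lemma mem_tPowSpan_zero {x : LaurentSeries k} :
    x ∈ tPowSpan k 0 ↔ x ∈ Set.range (algebraMap (PowerSeries k) (LaurentSeries k)) := by
  simp [tPowSpan, Submodule.mem_span_singleton, Algebra.smul_def]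

lemma tPowSpan_antitone : Antitone (tPowSpan k) := by
  intro m n h
  refine (Submodule.span_singleton_le_iff_mem _ _).2 (Submodule.mem_span_singleton.2 ?_)
  obtain ⟨j, rfl⟩ := Int.le.dest h
  refine ⟨PowerSeries.X ^ j, ?_⟩
  rw [Algebra.smul_def, map_pow, zpow_add₀ tK_ne_zero, zpow_natCast, mul_comm]
  rfl

lemma zpow_mem_tPowSpan_iff {m n : ℤ} : tK k ^ n ∈ tPowSpan k m ↔ m ≤ n := by
  refine ⟨fun h => ?_, fun h => tPowSpan_antitone h (zpow_mem_tPowSpan n)⟩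
  by_contra! hlt
  obtain ⟨c, hc⟩ := Submodule.mem_span_singleton.1
    (tPowSpan_antitone (show n + 1 ≤ m by lia) h)
  rw [Algebra.smul_def, zpow_add_one₀ tK_ne_zero, mul_left_comm] at hc
  have h1 := mul_left_cancel₀ (zpow_ne_zero n tK_ne_zero) (hc.trans (mul_one _).symm)
  rw [tK, ← map_mul, ← map_one (algebraMap (PowerSeries k) (LaurentSeries k))] at h1
  have h3 := FaithfulSMul.algebraMap_injective _ _ h1
  simpa using congrArg PowerSeries.constantCoeff h3

lemma mem_boxL {a : Fin 8 → ℤ} {x : C8 k} : x ∈ boxL k a ↔ ∀ i, x i ∈ tPowSpan k (a i) := by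
  simp [boxL]

lemma smul_E_mem_boxL {a : Fin 8 → ℤ} {i : Fin 8} {z : LaurentSeries k}
    (hz : z ∈ tPowSpan k (a i)) : z • E k i ∈ boxL k a := by
  refine mem_boxL.2 fun j => ?_
  obtain rfl | h := eq_or_ne j i
  · simpa [E] using hz
  · simp [E, h]

lemma boxL_le_boxL {a b : Fin 8 → ℤ} : boxL k a ≤ boxL k b ↔ b ≤ a := by
  refine ⟨fun h i => ?_, fun h x hx => ?_⟩
  · have := mem_boxL.1 (h (smul_E_mem_boxL (zpow_mem_tPowSpan (a i)))) i
    simpa [E, zpow_mem_tPowSpan_iff] using this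
  · exact mem_boxL.2 fun i => tPowSpan_antitone (h i) (mem_boxL.1 hx i)

lemma boxL_lt_boxL {a b : Fin 8 → ℤ} : boxL k a < boxL k b ↔ b < a := by
  simp only [lt_iff_le_not_ge, boxL_le_boxL]

lemma boxL_le {a : Fin 8 → ℤ} {N : Submodule (PowerSeries k) (C8 k)}
    (h : ∀ i, tK k ^ a i • E k i ∈ N) : boxL k a ≤ N := by
  intro x hx
  have hsum : x = ∑ i, x i • E k i := by
    ext j
    simp [E, Finset.sum_apply, Pi.single_apply]
  rw [hsum]
  refine N.sum_mem fun i _ => ?_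
  obtain ⟨c, hc⟩ := Submodule.mem_span_singleton.1 (mem_boxL.1 hx i)
  rw [← hc, smul_assoc]
  exact N.smul_mem c (h i)

lemma span_range_eq_boxL (a : Fin 8 → ℤ) :
    Submodule.span (PowerSeries k) (Set.range fun i => tK k ^ a i • E k i) = boxL k a := by
  refine le_antisymm (Submodule.span_le.2 ?_)
    (boxL_le fun i => Submodule.subset_span (Set.mem_range_self i))
  rintro _ ⟨i, rfl⟩
  exact smul_E_mem_boxL (zpow_mem_tPowSpan _)

lemma L3_eq_boxL : L3 k = boxL k ![0, 0, 1, 1, 0, 0, 0, 1] := by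
  rw [← span_range_eq_boxL, L3]
  congr 1
  ext x
  simp [Fin.exists_fin_succ, eq_comm]

lemma bf8_eq_sum (x y : C8 k) : bf8 k x y = ∑ i, x i * y (dualIdx i) := by
  simp [bf8, Fin.sum_univ_eight, dualIdx]
  ring

lemma dualIdx_dualIdx (i : Fin 8) : dualIdx (dualIdx i) = i := by
  revert i; decide

lemma dualL_boxL (a : Fin 8 → ℤ) : dualL k (boxL k a) = boxL k fun i => -a (dualIdx i) := by
  refine le_antisymm (Submodule.span_le.2 fun x hx => mem_boxL.2 fun i => ?_)
    fun x hx => Submodule.subset_span fun y hy => ?_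
  · have h := mem_tPowSpan_zero.2
      (hx _ (smul_E_mem_boxL (zpow_mem_tPowSpan (a (dualIdx i)))))
    have hinj (j : Fin 8) : dualIdx j = dualIdx i ↔ j = i :=
      (Function.LeftInverse.injective dualIdx_dualIdx).eq_iff
    rw [bf8_eq_sum] at h
    simp only [E, Pi.smul_apply, Pi.single_apply, hinj, smul_eq_mul, mul_ite, mul_one, mul_zero,
      Finset.sum_ite_eq', Finset.mem_univ, if_true] at h
    have h' := mul_mem_tPowSpan h (zpow_mem_tPowSpan (-a (dualIdx i)))
    rwa [mul_assoc, ← zpow_add₀ tK_ne_zero, add_neg_cancel, zpow_zero, mul_one, zero_add] at h'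
  · rw [← mem_tPowSpan_zero, bf8_eq_sum]
    refine Submodule.sum_mem _ fun i _ => ?_
    simpa using mul_mem_tPowSpan (mem_boxL.1 hx i) (mem_boxL.1 hy (dualIdx i))

lemma zpow_smul_mem_boxL {a : Fin 8 → ℤ} {x : C8 k} (n : ℤ) (hx : x ∈ boxL k a) :
    tK k ^ n • x ∈ boxL k fun i => n + a i :=
  mem_boxL.2 fun i => mul_mem_tPowSpan (zpow_mem_tPowSpan n) (mem_boxL.1 hx i)

lemma tinvL_boxL (a : Fin 8 → ℤ) : tinvL k (boxL k a) = boxL k fun i => -1 + a i := by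
  refine le_antisymm (Submodule.span_le.2 ?_) (boxL_le fun i => Submodule.subset_span ?_)
  · rintro _ ⟨x, hx, rfl⟩
    simpa using zpow_smul_mem_boxL (-1) hx
  · refine ⟨_, smul_E_mem_boxL (zpow_mem_tPowSpan (a i)), ?_⟩
    simp [smul_smul, zpow_add₀ tK_ne_zero]

lemma smul_E_mem_boxL_of_le {c : Fin 8 → ℤ} {m : ℤ} {n : Fin 8} {z : LaurentSeries k}
    (hz : z ∈ tPowSpan k m) (h : c n ≤ m) : z • E k n ∈ boxL k c :=
  smul_E_mem_boxL (tPowSpan_antitone h hz)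

lemma bmul_cases (i j : Fin 8) :
    bmul k i j = 0 ∨ ∃ n ∈ prodIdx i j, bmul k i j = E k n ∨ bmul k i j = -E k n := by
  fin_cases i <;> fin_cases j <;> simp [bmul, prodIdx]

lemma star8_mem_boxL {a b c : Fin 8 → ℤ} (h : ∀ i j, ∀ n ∈ prodIdx i j, c n ≤ a i + b j)
    {x y : C8 k} (hx : x ∈ boxL k a) (hy : y ∈ boxL k b) : star8 k x y ∈ boxL k c := by
  refine Submodule.sum_mem _ fun i _ => Submodule.sum_mem _ fun j _ => ?_
  have hz := mul_mem_tPowSpan (mem_boxL.1 hx i) (mem_boxL.1 hy j)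
  obtain h0 | ⟨n, hn, h1 | h1⟩ := bmul_cases (k := k) i j
  · simp [h0]
  · rw [h1]
    exact smul_E_mem_boxL_of_le hz (h i j n hn)
  · rw [h1, smul_neg]
    exact neg_mem (smul_E_mem_boxL_of_le hz (h i j n hn))

lemma star8_smul_E (z w : LaurentSeries k) (i j : Fin 8) :
    star8 k (z • E k i) (w • E k j) = (z * w) • bmul k i j := by
  rw [star8, Finset.sum_eq_single i, Finset.sum_eq_single j]
  · simp [E]
  · intro b _ hb
    simp [E, hb]
  · simp
  · intro b _ hb
    simp [E, hb]
  · simp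

lemma star8_mem_L3 {x y : C8 k} (hx : x ∈ L3 k) (hy : y ∈ L3 k) : star8 k x y ∈ L3 k := by
  rw [L3_eq_boxL] at *
  exact star8_mem_boxL (by decide) hx hy

lemma dualL_L3_eq_boxL : dualL k (L3 k) = boxL k ![0, 0, 0, 0, -1, -1, -1, 0] := by
  rw [L3_eq_boxL, dualL_boxL]
  congr 1
  decide

lemma star8_mem_of_mem_dualL_L3 {x y : C8 k} (hx : x ∈ dualL k (L3 k)) (hy : y ∈ dualL k (L3 k)) :
    star8 k x y ∈ boxL k ![-1, -1, -1, -1, -2, -1, -1, 0] := by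
  rw [dualL_L3_eq_boxL] at hx hy
  exact star8_mem_boxL (by decide) hx hy

lemma smul_bmul_mem_M3 {i j : Fin 8} {m n : ℤ}
    (hm : (![0, 0, 0, 0, -1, -1, -1, 0] : Fin 8 → ℤ) i ≤ m)
    (hn : (![0, 0, 0, 0, -1, -1, -1, 0] : Fin 8 → ℤ) j ≤ n) :
    tK k ^ (1 + (m + n)) • bmul k i j ∈ M3 k := by
  refine Submodule.mem_sup_left (Submodule.subset_span
    ⟨_, ⟨tK k ^ m • E k i, ?_, tK k ^ n • E k j, ?_, rfl⟩, ?_⟩)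
  · rw [dualL_L3_eq_boxL]
    exact smul_E_mem_boxL_of_le (zpow_mem_tPowSpan m) hm
  · rw [dualL_L3_eq_boxL]
    exact smul_E_mem_boxL_of_le (zpow_mem_tPowSpan n) hn
  · simp only [star8_smul_E, smul_smul]
    rw [zpow_add₀ tK_ne_zero, zpow_add₀ tK_ne_zero, zpow_one]

lemma M3_eq_boxL : M3 k = boxL k ![0, 0, 0, 0, -1, 0, 0, 1] := by
  refine le_antisymm (sup_le (Submodule.span_le.2 ?_) ?_) (boxL_le fun i => ?_)
  · rintro _ ⟨_, ⟨x, hx, y, hy, rfl⟩, rfl⟩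
    have h := zpow_smul_mem_boxL 1 (star8_mem_of_mem_dualL_L3 hx hy)
    rw [zpow_one] at h
    exact boxL_le_boxL.2 (Pi.le_def.2 (by decide)) h
  · rw [L3_eq_boxL]
    exact boxL_le_boxL.2 (Pi.le_def.2 (by decide))
  · have hL (i : Fin 8) {n : ℤ} (h : (![0, 0, 1, 1, 0, 0, 0, 1] : Fin 8 → ℤ) i ≤ n) :
        tK k ^ n • E k i ∈ M3 k := by
      refine Submodule.mem_sup_right ?_
      rw [L3_eq_boxL]
      exact smul_E_mem_boxL_of_le (zpow_mem_tPowSpan n) h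
    fin_cases i
    · simpa using hL 0 (n := 0) (by decide)
    · simpa using hL 1 (n := 0) (by decide)
    · simpa [bmul] using smul_bmul_mem_M3 (k := k) (i := 6) (j := 7) (m := -1) (n := 0)
        (by decide) (by decide)
    · simpa [bmul] using smul_bmul_mem_M3 (k := k) (i := 7) (j := 5) (m := 0) (n := -1)
        (by decide) (by decide)
    · simpa [bmul] using smul_bmul_mem_M3 (k := k) (i := 5) (j := 6) (m := -1) (n := -1)
        (by decide) (by decide)
    · simpa using hL 5 (n := 0) (by decide)
    · simpa using hL 6 (n := 0) (by decide)
    · simpa using hL 7 (n := 1) (by decide)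

end

/-- The standard lattice `𝕃₃` is closed under `⋆`, satisfies
`𝕃₃ ⊊ 𝕃₃^∨ ⊊ t⁻¹𝕃₃`, and `M := t·(𝕃₃^∨ ⋆ 𝕃₃^∨) + 𝕃₃` equals
`k[[t]]⟨e₁, e₂, u₁, u₂, t⁻¹u₃, v₁, v₂, t·v₃⟩` and is self-dual. -/
theorem standard_lattice_type_three (k : Type*) [Field k] (h2 : (2 : k) ≠ 0) :
    (∀ x ∈ L3 k, ∀ y ∈ L3 k, star8 k x y ∈ L3 k) ∧
    L3 k < dualL k (L3 k) ∧
    dualL k (L3 k) < tinvL k (L3 k) ∧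
    M3 k = Submodule.span (PowerSeries k)
        {E k 0, E k 1, E k 2, E k 3, (tK k)⁻¹ • E k 4, E k 5, E k 6, tK k • E k 7} ∧
    dualL k (M3 k) = M3 k := by
  refine ⟨fun x hx y hy => star8_mem_L3 hx hy, ?_, ?_, ?_, ?_⟩
  · rw [dualL_L3_eq_boxL, L3_eq_boxL, boxL_lt_boxL, Pi.lt_def, Pi.le_def]
    decide
  · rw [dualL_L3_eq_boxL, L3_eq_boxL, tinvL_boxL, boxL_lt_boxL, Pi.lt_def, Pi.le_def]
    decide
  · rw [M3_eq_boxL, ← span_range_eq_boxL]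
    congr 1
    ext x
    simp [Fin.exists_fin_succ, eq_comm]
  · rw [M3_eq_boxL, dualL_boxL]
    congr 1
    decide
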